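/- Every cube of side M that intersects the boundary of a scaled convex body mL is contained in the (√N·M)-neighborhood of ∂(mL), and the Lebesgue measure of the r-neighborhood of the boundary of a convex body K ⊆ ℝ^N satisfies Vol({x : dist(x, ∂K) ≤ r}) ≤ C·r·(diam K + r)^{N−1} for a dimensional constant C. -/

import Mathlib

open MeasureTheory Metric Pointwise

/-- The Euclidean norm is at most `√N` times a bound on the coordinates. -/
lemma EuclideanSpace.norm_le_sqrt_mul_of_abs_le {N : ℕ} {a : ℝ} (ha : 0 ≤ a)
    (x : EuclideanSpace ℝ (Fin N)) (h : ∀ i, |x i| ≤ a) : ‖x‖ ≤ Real.sqrt N * a := by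
  rw [EuclideanSpace.norm_eq, ← Real.sqrt_sq ha, ← Real.sqrt_mul (Nat.cast_nonneg N)]
  apply Real.sqrt_le_sqrt
  calc ∑ i, ‖x i‖ ^ 2 ≤ ∑ _i : Fin N, a ^ 2 := by
        gcongr with i
        exact h i
    _ = N * a ^ 2 := by simp

/-- The Lebesgue measure of a box in Euclidean space. -/
lemma EuclideanSpace.volume_box {N : ℕ} (l u : Fin N → ℝ) :
    volume {x : EuclideanSpace ℝ (Fin N) | ∀ j, l j ≤ x j ∧ x j ≤ u j}
      = ∏ j, ENNReal.ofReal (u j - l j) := by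
  rw [← Real.volume_Icc_pi, ← (EuclideanSpace.volume_preserving_symm_measurableEquiv_toLp
    (Fin N)).symm.measure_preimage_equiv]
  congr 1
  ext x
  simp [Pi.le_def, forall_and]

/-- The translates of `A \ (A - v)` by multiples of `v` are disjoint when `A` is convex. -/
lemma Convex.pairwise_disjoint_translates_diff {E : Type*} [AddCommGroup E] [Module ℝ E]
    {A : Set E} (hA : Convex ℝ A) (v : E) :
    Pairwise (Function.onFun Disjoint
      fun k : ℕ => {x | x + (k : ℝ) • v ∈ A \ {y | y + v ∈ A}}) := by
  refine (pairwise_disjoint_on _).2 fun m n hmn => Set.disjoint_left.2 ?_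
  rintro x ⟨hm, hm'⟩ ⟨hn, -⟩
  refine hm' ?_
  have hmn' : (m : ℝ) + 1 ≤ n := by exact_mod_cast hmn
  have hpos : (0 : ℝ) < n - m := by linarith
  have key := hA.add_smul_sub_mem hm hn (t := 1 / ((n : ℝ) - m))
    ⟨by positivity, by rw [div_le_one hpos]; linarith⟩
  have e : x + (m : ℝ) • v + (1 / ((n : ℝ) - m)) • (x + (n : ℝ) • v - (x + (m : ℝ) • v))
      = x + (m : ℝ) • v + v := by
    rw [add_sub_add_left_eq_sub, ← sub_smul, smul_smul, one_div_mul_cancel hpos.ne', one_smul]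
  rwa [e] at key

/-- A compact convex set with diameter at most `D` loses a volume of order at most
`|s| D ^ (N - 1)` when intersected with its translate by `s` in a coordinate direction. -/
lemma Convex.volume_diff_translate_le {N : ℕ} {A : Set (EuclideanSpace ℝ (Fin N))}
    (hA : Convex ℝ A) (hc : IsClosed A) {D : ℝ} (hD : 0 < D)
    (hdiam : ∀ x ∈ A, ∀ y ∈ A, dist x y ≤ D) (i : Fin N) {s : ℝ} (hs : s ≠ 0) :
    volume (A \ {y | y + EuclideanSpace.single i s ∈ A})
      ≤ ENNReal.ofReal (4 * |s| * (2 * D) ^ (N - 1)) := by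
  rcases A.eq_empty_or_nonempty with rfl | ⟨p, hp⟩
  · simp
  set v : EuclideanSpace ℝ (Fin N) := EuclideanSpace.single i s
  set W := A \ {y | y + v ∈ A}
  have hs' : 0 < |s| := abs_pos.2 hs
  have hWm : MeasurableSet W :=
    hc.measurableSet.diff ((measurable_add_const v) hc.measurableSet)
  obtain ⟨n, hn⟩ := exists_nat_ge (D / |s|)
  rw [div_le_iff₀ hs'] at hn
  have hn0 : 0 < (n : ℝ) := by
    by_contra! h
    nlinarith
  let w : Fin N → ℝ := fun j => if j = i then D + n * |s| else D
  let T : ℕ → Set (EuclideanSpace ℝ (Fin N)) := fun k => {x | x + (k : ℝ) • v ∈ W}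
  have hT : ∀ k, volume (T k) = volume W := fun k =>
    measure_preimage_add_right volume ((k : ℝ) • v) W
  have hTm : ∀ k, MeasurableSet (T k) := fun k => (measurable_add_const _) hWm
  have hsub : (⋃ k ∈ Finset.range n, T k) ⊆ {x | ∀ j, p j - w j ≤ x j ∧ x j ≤ p j + w j} := by
    intro x hx j
    simp only [Set.mem_iUnion, Finset.mem_range] at hx
    obtain ⟨k, hk, hx⟩ := hx
    have h1 : |x j + k * v j - p j| ≤ D := by
      have := (PiLp.norm_apply_le (x + (k : ℝ) • v - p) j).trans
        ((dist_eq_norm _ _).symm.trans_le (hdiam _ hx.1 _ hp))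
      simpa using this
    have h2 : D + |k * v j| ≤ w j := by
      by_cases hj : j = i
      · subst hj
        have : (k : ℝ) ≤ n := by exact_mod_cast hk.le
        simp only [v, w, if_true, abs_mul, Nat.abs_cast, PiLp.single_apply]
        gcongr
      · simp [v, w, hj]
    have h3 := abs_le.1 h1
    have h4 := abs_le.1 (le_refl |k * v j|)
    constructor <;> linarith
  have hvol : (n : ENNReal) * volume W ≤ ENNReal.ofReal (2 * (D + n * |s|) * (2 * D) ^ (N - 1)) := by
    calc (n : ENNReal) * volume W = ∑ k ∈ Finset.range n, volume (T k) := by simp [hT]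
      _ = volume (⋃ k ∈ Finset.range n, T k) :=
        (measure_biUnion_finset (fun a _ b _ hab => hA.pairwise_disjoint_translates_diff v hab)
          fun k _ => hTm k).symm
      _ ≤ _ := measure_mono hsub
      _ = ∏ j, ENNReal.ofReal (2 * w j) := by
        rw [EuclideanSpace.volume_box (fun j => p j - w j) (fun j => p j + w j)]
        congr! 2
        ring
      _ = ENNReal.ofReal (2 * w i) * ∏ j ∈ Finset.univ.erase i, ENNReal.ofReal (2 * w j) :=
        (Finset.mul_prod_erase _ _ (Finset.mem_univ i)).symm
      _ = ENNReal.ofReal (2 * w i) * ENNReal.ofReal (2 * D) ^ (N - 1) := by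
        rw [Finset.prod_congr rfl (g := fun _ => ENNReal.ofReal (2 * D))
          (fun j hj => by simp [w, Finset.ne_of_mem_erase hj])]
        simp
      _ = _ := by
        rw [← ENNReal.ofReal_pow (by positivity), ← ENNReal.ofReal_mul (by simp [w]; positivity)]
        simp [w]
  have hle : (n : ENNReal) * volume W ≤ n * ENNReal.ofReal (4 * |s| * (2 * D) ^ (N - 1)) := by
    refine hvol.trans ?_
    rw [← ENNReal.ofReal_natCast n, ← ENNReal.ofReal_mul hn0.le]
    apply ENNReal.ofReal_le_ofReal
    rw [← mul_assoc]
    refine mul_le_mul_of_nonneg_right ?_ (by positivity)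
    linarith
  exact (ENNReal.mul_le_mul_iff_right (by exact_mod_cast hn0.ne') (ENNReal.natCast_ne_top n)).1 hle

/-- A point of the outer parallel body outside the inner one leaves the outer parallel body
when moved by `2 r √N` in a suitable coordinate direction. -/
lemma Convex.exists_coordinate_translate_notMem_cthickening {N : ℕ} (hN : 1 ≤ N)
    {K : Set (EuclideanSpace ℝ (Fin N))} (hK : Convex ℝ K) (hc : IsCompact K) {r : ℝ}
    (hr : 0 < r) {x : EuclideanSpace ℝ (Fin N)} (hx : ¬ closedBall x r ⊆ K) :
    ∃ i : Fin N, ∃ s : ℝ, (s = 2 * r * Real.sqrt N ∨ s = -(2 * r * Real.sqrt N)) ∧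
      x + EuclideanSpace.single i s ∉ Metric.cthickening r K := by
  obtain ⟨y, hy, hyK⟩ := Set.not_subset.1 hx
  obtain ⟨f, u, hfK, hfy⟩ := geometric_hahn_banach_closed_point hK hc.isClosed hyK
  obtain ⟨w, rfl⟩ := (InnerProductSpace.toDual ℝ (EuclideanSpace ℝ (Fin N))).surjective f
  simp only [InnerProductSpace.toDual_apply_apply] at hfK hfy
  have : Nonempty (Fin N) := ⟨⟨0, hN⟩⟩
  obtain ⟨i, hi⟩ := Finite.exists_max fun j => |w j|
  have hw := EuclideanSpace.norm_le_sqrt_mul_of_abs_le (abs_nonneg (w i)) w hi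
  have hlip : ∀ a b : EuclideanSpace ℝ (Fin N), dist a b ≤ r →
      inner ℝ w a ≤ inner ℝ w b + ‖w‖ * r := by
    intro a b hab
    have h := real_inner_le_norm w (a - b)
    rw [inner_sub_right, ← dist_eq_norm] at h
    have := mul_le_mul_of_nonneg_left hab (norm_nonneg w)
    linarith
  obtain ⟨s, hs, hsw⟩ : ∃ s : ℝ, (s = 2 * r * Real.sqrt N ∨ s = -(2 * r * Real.sqrt N)) ∧
      s * w i = 2 * r * (Real.sqrt N * |w i|) := by
    rcases abs_choice (w i) with h | h
    · exact ⟨_, Or.inl rfl, by rw [h]; ring⟩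
    · exact ⟨_, Or.inr rfl, by rw [h]; ring⟩
  refine ⟨i, s, hs, fun hmem => ?_⟩
  rw [hc.cthickening_eq_biUnion_closedBall hr.le] at hmem
  simp only [Set.mem_iUnion, mem_closedBall] at hmem
  obtain ⟨a, ha, hda⟩ := hmem
  have h1 := hlip _ _ hda
  rw [inner_add_right, EuclideanSpace.inner_single_right] at h1
  simp only [conj_trivial] at h1
  have h2 := hlip _ _ (mem_closedBall.1 hy)
  have h3 := hfK a ha
  nlinarith

theorem boundary_neighborhood_volume (N : ℕ) (hN : 1 ≤ N) :
    (∀ (L : Set (EuclideanSpace ℝ (Fin N))), Convex ℝ L → IsCompact L →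
      (interior L).Nonempty → ∀ (m : ℝ) (M : ℝ), 0 < M →
      ∀ c : EuclideanSpace ℝ (Fin N),
      ∀ Q : Set (EuclideanSpace ℝ (Fin N)),
        Q = {x | ∀ i, c i ≤ x i ∧ x i ≤ c i + M} →
        (Q ∩ frontier (m • L)).Nonempty →
        Q ⊆ {x | infDist x (frontier (m • L)) ≤ Real.sqrt N * M}) ∧
    (∃ C : ℝ, 0 < C ∧ ∀ (K : Set (EuclideanSpace ℝ (Fin N))), Convex ℝ K →
      IsCompact K → (interior K).Nonempty → ∀ r : ℝ, 0 < r →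
      volume (cthickening r K \ {x | closedBall x r ⊆ K})
        ≤ ENNReal.ofReal (C * r * (diam K + 2 * r) ^ (N - 1))) := by
  have hN0 : (0 : ℝ) < N := by exact_mod_cast hN
  refine ⟨?_, N * (2 * (4 * (2 * Real.sqrt N) * 2 ^ (N - 1))), by positivity, ?_⟩
  · rintro L - - - m M hM c Q rfl ⟨z, hzQ, hz⟩ x hx
    refine (infDist_le_dist_of_mem hz).trans ?_
    rw [dist_eq_norm]
    refine EuclideanSpace.norm_le_sqrt_mul_of_abs_le hM.le _ fun i => ?_
    have h1 := hx i
    have h2 := hzQ i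
    rw [PiLp.sub_apply, abs_le]
    constructor <;> linarith
  · intro K hK hc _ r hr
    set t := 2 * r * Real.sqrt N with ht
    have ht0 : 0 < t := by positivity
    have hD : 0 < diam K + 2 * r := by linarith [diam_nonneg (s := K)]
    have hdiam : ∀ x ∈ cthickening r K, ∀ y ∈ cthickening r K, dist x y ≤ diam K + 2 * r :=
      fun x hx y hy => (dist_le_diam_of_mem hc.isBounded.cthickening hx hy).trans
        (diam_cthickening_le K hr.le)
    let W : Fin N → ℝ → Set (EuclideanSpace ℝ (Fin N)) := fun i s =>
      cthickening r K \ {y | y + EuclideanSpace.single i s ∈ cthickening r K}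
    have hW : ∀ i s, |s| = t →
        volume (W i s) ≤ ENNReal.ofReal (4 * t * (2 * (diam K + 2 * r)) ^ (N - 1)) := by
      intro i s hs
      rw [← hs]
      exact (hK.cthickening r).volume_diff_translate_le isClosed_cthickening hD hdiam i
        (abs_pos.1 (hs ▸ ht0))
    have hcover : cthickening r K \ {x | closedBall x r ⊆ K} ⊆ ⋃ i, (W i t ∪ W i (-t)) := by
      rintro x ⟨hx, hx'⟩
      obtain ⟨i, s, hs, hxs⟩ :=
        hK.exists_coordinate_translate_notMem_cthickening hN hc hr hx'
      refine Set.mem_iUnion.2 ⟨i, ?_⟩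
      rcases hs with rfl | rfl
      · exact Or.inl ⟨hx, hxs⟩
      · exact Or.inr ⟨hx, hxs⟩
    calc volume (cthickening r K \ {x | closedBall x r ⊆ K})
        ≤ volume (⋃ i, (W i t ∪ W i (-t))) := measure_mono hcover
      _ ≤ ∑ i, volume (W i t ∪ W i (-t)) := measure_iUnion_fintype_le _ _
      _ ≤ ∑ _i : Fin N, 2 * ENNReal.ofReal (4 * t * (2 * (diam K + 2 * r)) ^ (N - 1)) := by
        refine Finset.sum_le_sum fun i _ => (measure_union_le _ _).trans ?_
        rw [two_mul]
        exact add_le_add (hW i t (abs_of_pos ht0)) (hW i (-t) (by rw [abs_neg, abs_of_pos ht0]))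
      _ = ENNReal.ofReal (N * (2 * (4 * t * (2 * (diam K + 2 * r)) ^ (N - 1)))) := by
        rw [ENNReal.ofReal_mul hN0.le, ENNReal.ofReal_mul zero_le_two]
        simp
      _ = _ := by
        congr 1
        rw [ht, mul_pow]
        ring
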